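/- arXiv:2212.11165 — 2 statements merged into one kernel-verified Lean document; each statement's English description precedes it below -/
import Mathlib

section
/- Let G be a finite connected simple graph, let α ≥ 2 be a natural number, and let C₁, …, C_m be nonempty sets of vertices of G with d(C_i, C_j) ≥ α for all i ≠ j. Let a, b, c, e be vertices of G such that a is adjacent to b, b is adjacent to c, and c is adjacent to e. Suppose there are indices s and t such that d(C_s, b) + d(C_t, e) = α − 2 and 2·d(C_s, b) ≤ α − 2. Then for any indices p, q with d(C_p, a) + d(C_q, c) = α − 2, either p = s or q = s. -/
/-- The distance between two vertex sets: the minimum of the graph distance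
over pairs of vertices from the two sets. -/
noncomputable def setDist {V : Type*} (G : SimpleGraph V) (A B : Set V) : ℕ :=
  sInf {n | ∃ a ∈ A, ∃ b ∈ B, G.dist a b = n}

theorem exists_dist_eq_setDist {V : Type*} (G : SimpleGraph V) {A B : Set V}
    (hA : A.Nonempty) (hB : B.Nonempty) :
    ∃ a ∈ A, ∃ b ∈ B, G.dist a b = setDist G A B := by
  obtain ⟨a, ha⟩ := hA
  obtain ⟨b, hb⟩ := hB
  exact Nat.sInf_mem (s := {n | ∃ a ∈ A, ∃ b ∈ B, G.dist a b = n}) ⟨_, a, ha, b, hb, rfl⟩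

theorem setDist_le_dist {V : Type*} (G : SimpleGraph V) {A B : Set V} {a b : V}
    (ha : a ∈ A) (hb : b ∈ B) : setDist G A B ≤ G.dist a b :=
  Nat.sInf_le ⟨a, ha, b, hb, rfl⟩

/-- Triangle inequality for two vertex sets joined through an edge. -/
theorem setDist_le_of_adj {V : Type*} {G : SimpleGraph V} (hG : G.Connected) {A B : Set V}
    (hA : A.Nonempty) (hB : B.Nonempty) {u v : V} (huv : G.Adj u v) :
    setDist G A B ≤ setDist G A {u} + 1 + setDist G B {v} := by
  obtain ⟨x, hx, _, rfl, hxu⟩ := exists_dist_eq_setDist G hA (Set.singleton_nonempty u)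
  obtain ⟨y, hy, _, rfl, hyv⟩ := exists_dist_eq_setDist G hB (Set.singleton_nonempty v)
  rw [← hxu, ← hyv, ← SimpleGraph.dist_eq_one_iff_adj.mpr huv, G.dist_comm (u := y)]
  exact (setDist_le_dist G hx hy).trans <|
    hG.dist_triangle.trans (Nat.add_le_add_right hG.dist_triangle _)

theorem stmt3 {V : Type*} [Fintype V] (G : SimpleGraph V) (hG : G.Connected)
    (α : ℕ) (hα : 2 ≤ α) (m : ℕ) (C : Fin m → Set V)
    (hne : ∀ i, (C i).Nonempty)
    (hfar : ∀ i j, i ≠ j → α ≤ setDist G (C i) (C j))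
    (a b c e : V) (hab : G.Adj a b) (hbc : G.Adj b c) (hce : G.Adj c e)
    (s t : Fin m)
    (hst : setDist G (C s) {b} + setDist G (C t) {e} = α - 2)
    (hhalf : 2 * setDist G (C s) {b} ≤ α - 2)
    (p q : Fin m)
    (hpq : setDist G (C p) {a} + setDist G (C q) {c} = α - 2) :
    p = s ∨ q = s := by
  by_contra! h
  have hps := (hfar p s h.1).trans (setDist_le_of_adj hG (hne p) (hne s) hab)
  have hqs := (hfar q s h.2).trans (setDist_le_of_adj hG (hne q) (hne s) hbc.symm)
  omega
end

section
/- Let k ≥ 1 and let P be the path graph with vertices v₀, v₁, …, v_k and edges v_i v_{i+1} for 0 ≤ i < k. Let L be a list-assignment for P such that |L(v_i)| ≥ 3 for every internal vertex v_i (0 < i < k). Let A ⊆ L(v₀) and A′ ⊆ L(v_k) be nonempty sets with |A| + |A′| ≥ 4. Then there exists an L-coloring φ of {v₀, …, v_k} such that φ(v₀) ∈ A and φ(v_k) ∈ A′. -/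
/-- The path graph on vertices `0, 1, …, k`, whose only edges join consecutive
vertices. -/
def pathG (k : ℕ) : SimpleGraph (Fin (k + 1)) :=
  SimpleGraph.fromRel (fun i j => (i : ℕ) + 1 = (j : ℕ))

/-- Two nonempty finite sets with at least four elements in total, counted with multiplicity,
contain a pair of distinct elements. -/
lemma exists_ne_of_four_le_card_add_card {A B : Finset ℕ} (hA : A.Nonempty) (hB : B.Nonempty)
    (h : 4 ≤ A.card + B.card) : ∃ a ∈ A, ∃ b ∈ B, a ≠ b := by
  by_cases h1 : 1 < B.card
  · obtain ⟨a, ha⟩ := hA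
    obtain ⟨b, hb, hne⟩ := Finset.exists_mem_ne h1 a
    exact ⟨a, ha, b, hb, hne.symm⟩
  · obtain ⟨b, hb⟩ := hB
    obtain ⟨a, ha, hne⟩ := Finset.exists_mem_ne (show 1 < A.card by omega) b
    exact ⟨a, ha, b, hb, hne⟩

/-- If `M` has at least three colors, the colors of `M` that extend some color in `A` are
as numerous as needed to replace `A` by them. -/
lemma exists_extendable_colors {A B M : Finset ℕ} (hA : A.Nonempty) (hB : B.Nonempty)
    (h : 4 ≤ A.card + B.card) (hM : 3 ≤ M.card) :
    ∃ N ⊆ M, N.Nonempty ∧ 4 ≤ N.card + B.card ∧ ∀ c ∈ N, ∃ a ∈ A, a ≠ c := by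
  have hB' := hB.card_pos
  by_cases h1 : 1 < A.card
  · exact ⟨M, Finset.Subset.refl M, Finset.card_pos.mp (by omega), by omega,
      fun c _ => Finset.exists_mem_ne h1 c⟩
  · obtain ⟨a, ha⟩ := hA
    have hAc : 0 < A.card := Finset.card_pos.mpr ⟨a, ha⟩
    have hN := Finset.pred_card_le_card_erase (s := M) (a := a)
    exact ⟨M.erase a, Finset.erase_subset a M, Finset.card_pos.mp (by omega), by omega,
      fun c hc => ⟨a, ha, (Finset.ne_of_mem_erase hc).symm⟩⟩

/-- List-coloring of a path indexed by natural numbers, with prescribed sets of colors `A` and `B`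
for its two ends. -/
lemma exists_path_list_coloring (B : Finset ℕ) (hB : B.Nonempty) (k : ℕ) :
    ∀ (L : ℕ → Finset ℕ) (A : Finset ℕ), (∀ i < k, 3 ≤ (L i).card) → A.Nonempty →
      4 ≤ A.card + B.card →
      ∃ φ : ℕ → ℕ, φ 0 ∈ A ∧ φ (k + 1) ∈ B ∧ (∀ i < k, φ (i + 1) ∈ L i) ∧
        ∀ i ≤ k, φ i ≠ φ (i + 1) := by
  induction k with
  | zero =>
    intro L A _ hA h
    obtain ⟨a, ha, b, hb, hne⟩ := exists_ne_of_four_le_card_add_card hA hB h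
    refine ⟨fun i => if i = 0 then a else b, by simpa, by simpa, by simp, ?_⟩
    intro i hi
    obtain rfl : i = 0 := by omega
    simpa
  | succ k ih =>
    intro L A hL hA h
    obtain ⟨N, hNL, hN, hcard, hext⟩ := exists_extendable_colors hA hB h (hL 0 (by omega))
    obtain ⟨ψ, hψ0, hψB, hψL, hψ⟩ :=
      ih (fun i => L (i + 1)) N (fun i hi => hL (i + 1) (by omega)) hN hcard
    obtain ⟨a, ha, hne⟩ := hext _ hψ0
    refine ⟨fun i => Nat.casesOn i a ψ, ha, hψB, ?_, ?_⟩
    · rintro (_ | i) hi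
      · exact hNL hψ0
      · exact hψL i (by omega)
    · rintro (_ | i) hi
      · exact hne
      · exact hψ i (by omega)

theorem stmt4 (k : ℕ) (hk : 1 ≤ k) (L : Fin (k + 1) → Finset ℕ)
    (hL : ∀ i : Fin (k + 1), 0 < (i : ℕ) → (i : ℕ) < k → 3 ≤ (L i).card)
    (A A' : Finset ℕ) (hA : A ⊆ L 0) (hA' : A' ⊆ L (Fin.last k))
    (hAne : A.Nonempty) (hA'ne : A'.Nonempty) (hcard : 4 ≤ A.card + A'.card) :
    ∃ φ : Fin (k + 1) → ℕ, (∀ i, φ i ∈ L i) ∧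
      (∀ i j, (pathG k).Adj i j → φ i ≠ φ j) ∧
      φ 0 ∈ A ∧ φ (Fin.last k) ∈ A' := by
  obtain ⟨m, rfl⟩ : ∃ m, k = m + 1 := ⟨k - 1, by omega⟩
  obtain ⟨φ, h0, hlast, hmem, hne⟩ := exists_path_list_coloring A' hA'ne m
    (fun i => L (Fin.ofNat (m + 1 + 1) (i + 1))) A
    (fun i hi => by
      have hval : ((Fin.ofNat (m + 1 + 1) (i + 1) : Fin (m + 1 + 1)) : ℕ) = i + 1 :=
        Nat.mod_eq_of_lt (by omega)
      exact hL _ (by omega) (by omega)) hAne hcard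
  refine ⟨fun i => φ i, ?_, ?_, h0, hlast⟩
  · rintro ⟨_ | i, hi⟩
    · exact hA h0
    · obtain rfl | him := eq_or_ne i m
      · exact hA' hlast
      · have heq : Fin.ofNat (m + 1 + 1) (i + 1) = ⟨i + 1, hi⟩ :=
          Fin.ext (Nat.mod_eq_of_lt hi)
        simpa only [heq] using hmem i (by omega)
  · intro i j hij
    obtain ⟨-, h | h⟩ := (SimpleGraph.fromRel_adj _ _ _).mp hij
    · simpa only [h] using hne i (by omega)
    · simpa only [h] using (hne j (by omega)).symm
end
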